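/- For any positive integers w1, w2, w3, any complex number y, and any nonnegative integer n: Σ_{k+l+m=n} (n choose k,l,m) E_{k,χ}(w1 y) E_{l,χ}(w2 y) E_{m,χ}(w3 y) w3^{k} w1^{l} w2^{m} = Σ_{k+l+m=n} (n choose k,l,m) E_{k,χ}(w1 y) E_{l,χ}(w3 y) E_{m,χ}(w2 y) w2^{k} w1^{l} w3^{m}. -/

import Mathlib

open Finset

/-- The formal exponential power series `e^{ct} = Σ cⁿ tⁿ/n!` in `ℂ[[t]]`. -/
noncomputable def expPS (c : ℂ) : PowerSeries ℂ :=
  PowerSeries.mk fun n => c ^ n / n.factorial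

/-- `Σ_{a=0}^{d-1} (-1)^a χ(a) e^{at}` as a formal power series. -/
noncomputable def altSum (χ : ℤ → ℂ) (d : ℕ) : PowerSeries ℂ :=
  ∑ a ∈ Finset.range d, ((-1 : ℂ) ^ a * χ (a : ℤ)) • expPS (a : ℂ)

/-- `E` is the family of generalized Euler polynomials attached to `χ` mod `d`:
`(Σ_{n≥0} E_{n,χ}(x) tⁿ/n!) · (e^{dt}+1) = 2 e^{xt} · Σ_{a=0}^{d-1} (-1)^a χ(a) e^{at}`. -/
def IsGenEuler (d : ℕ) (χ : ℤ → ℂ) (E : ℕ → ℂ → ℂ) : Prop :=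
  ∀ x : ℂ, (PowerSeries.mk fun n => E n x / n.factorial) * (expPS (d : ℂ) + 1)
    = (2 : PowerSeries ℂ) * expPS x * altSum χ d

/-- The alternating generalized power sum `T_k(n,χ) = Σ_{a=0}^{n} (-1)^a χ(a) a^k`
(with the convention `0^0 = 1`). -/
noncomputable def altPowSum (χ : ℤ → ℂ) (k n : ℕ) : ℂ :=
  ∑ a ∈ Finset.range (n + 1), (-1 : ℂ) ^ a * χ (a : ℤ) * (a : ℂ) ^ k

/-- The multinomial coefficient `(k+l+m)! / (k! l! m!)`. -/
def multinom (k l m : ℕ) : ℕ :=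
  (k + l + m).factorial / (k.factorial * l.factorial * m.factorial)

open PowerSeries in
theorem expPS_eq_rescale_exp (c : ℂ) : expPS c = rescale c (exp ℂ) := by
  ext n
  simp [expPS, coeff_exp, div_eq_mul_inv]

theorem expPS_mul_expPS (a b : ℂ) : expPS a * expPS b = expPS (a + b) := by
  simp only [expPS_eq_rescale_exp, PowerSeries.exp_mul_exp_eq_exp_add]

theorem rescale_expPS (w x : ℂ) : PowerSeries.rescale w (expPS x) = expPS (w * x) := by
  simp only [expPS_eq_rescale_exp, PowerSeries.rescale_rescale, mul_comm]

theorem expPS_add_one_ne_zero (c : ℂ) : expPS c + 1 ≠ 0 := by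
  intro h
  have h0 := congrArg (PowerSeries.coeff 0) h
  norm_num [expPS] at h0

theorem multinom_cast (k l m : ℕ) :
    (multinom k l m : ℂ) =
      (k + l + m).factorial / (k.factorial * l.factorial * m.factorial) := by
  have hdvd : k.factorial * l.factorial * m.factorial ∣ (k + l + m).factorial :=
    (Nat.mul_dvd_mul_right (Nat.factorial_mul_factorial_dvd_factorial_add k l) _).trans
      (Nat.factorial_mul_factorial_dvd_factorial_add (k + l) m)
  rw [multinom, Nat.cast_div hdvd (by simp [Nat.factorial_ne_zero])]
  push_cast
  rfl

/-- The exponential generating series `Σ fₙ tⁿ/n!` of a sequence. -/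
noncomputable def expGenSeries (f : ℕ → ℂ) : PowerSeries ℂ :=
  PowerSeries.mk fun n => f n / n.factorial

/-- The multinomial convolution of three scaled sequences is read off from the product of their
rescaled exponential generating series. -/
theorem sum_multinom_eq_coeff (f g h : ℕ → ℂ) (a b c : ℂ) (n : ℕ) :
    (∑ k ∈ range (n + 1), ∑ l ∈ range (n + 1 - k),
      (multinom k l (n - k - l) : ℂ) * f k * g l * h (n - k - l) *
        a ^ k * b ^ l * c ^ (n - k - l)) =
    n.factorial * PowerSeries.coeff n (PowerSeries.rescale a (expGenSeries f) *
      (PowerSeries.rescale b (expGenSeries g) * PowerSeries.rescale c (expGenSeries h))) := by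
  rw [PowerSeries.coeff_mul, Finset.Nat.sum_antidiagonal_eq_sum_range_succ_mk, mul_sum]
  refine sum_congr rfl fun k hk => ?_
  have hkn : k ≤ n := Nat.lt_succ_iff.mp (mem_range.mp hk)
  rw [PowerSeries.coeff_mul, Finset.Nat.sum_antidiagonal_eq_sum_range_succ_mk, mul_sum, mul_sum,
    Nat.succ_eq_add_one, ← Nat.sub_add_comm hkn]
  refine sum_congr rfl fun l hl => ?_
  have hln : k + l + (n - k - l) = n := by
    have := mem_range.mp hl
    omega
  rw [multinom_cast, hln]
  simp only [expGenSeries, PowerSeries.coeff_rescale, PowerSeries.coeff_mk]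
  field_simp

theorem IsGenEuler.rescale_expGenSeries_mul {d : ℕ} {χ : ℤ → ℂ} {E : ℕ → ℂ → ℂ}
    (hE : IsGenEuler d χ E) (w x : ℂ) :
    PowerSeries.rescale w (expGenSeries fun n => E n x) * (expPS (w * d) + 1) =
      2 * expPS (w * x) * PowerSeries.rescale w (altSum χ d) := by
  have h := congrArg (PowerSeries.rescale w) (hE x)
  simpa only [expGenSeries, map_mul, map_add, map_one, map_ofNat, rescale_expPS] using h

/-- Up to a factor depending only on the scales, the product of three rescaled generating series
depends on the arguments only through the total exponent. -/
theorem IsGenEuler.rescale_mul_rescale_mul_rescale {d : ℕ} {χ : ℤ → ℂ} {E : ℕ → ℂ → ℂ}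
    (hE : IsGenEuler d χ E) (a b c x y z : ℂ) :
    PowerSeries.rescale a (expGenSeries fun n => E n x) *
        (PowerSeries.rescale b (expGenSeries fun n => E n y) *
          PowerSeries.rescale c (expGenSeries fun n => E n z)) *
        ((expPS (a * d) + 1) * (expPS (b * d) + 1) * (expPS (c * d) + 1)) =
      8 * expPS (a * x + b * y + c * z) * (PowerSeries.rescale a (altSum χ d) *
        PowerSeries.rescale b (altSum χ d) * PowerSeries.rescale c (altSum χ d)) := by
  have ha := hE.rescale_expGenSeries_mul a x
  have hb := hE.rescale_expGenSeries_mul b y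
  have hc := hE.rescale_expGenSeries_mul c z
  rw [← expPS_mul_expPS, ← expPS_mul_expPS]
  linear_combination congrArg₂ (· * ·) (congrArg₂ (· * ·) ha hb) hc

/-- Theorem 7: two symmetries for the triple sum with three generalized Euler
polynomial factors in a single variable `y`. -/
theorem stmt_6 (d : ℕ) (hd : Odd d) (hd0 : 0 < d) (χ : ℤ → ℂ)
    (hper : ∀ a : ℤ, χ (a + d) = χ a)
    (hmul : ∀ a b : ℤ, χ (a * b) = χ a * χ b) (hone : χ 1 = 1)
    (hvan : ∀ a : ℤ, 1 < Int.gcd a d → χ a = 0)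
    (E : ℕ → ℂ → ℂ) (hE : IsGenEuler d χ E)
    (w1 w2 w3 : ℕ) (hw1 : 0 < w1) (hw2 : 0 < w2) (hw3 : 0 < w3)
    (y : ℂ) (n : ℕ) :
    (∑ k ∈ range (n + 1), ∑ l ∈ range (n + 1 - k),
      (multinom k l (n - k - l) : ℂ) * E k ((w1 : ℂ) * y) * E l ((w2 : ℂ) * y) *
        E (n - k - l) ((w3 : ℂ) * y) *
        (w3 : ℂ) ^ k * (w1 : ℂ) ^ l * (w2 : ℂ) ^ (n - k - l))
    = ∑ k ∈ range (n + 1), ∑ l ∈ range (n + 1 - k),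
      (multinom k l (n - k - l) : ℂ) * E k ((w1 : ℂ) * y) * E l ((w3 : ℂ) * y) *
        E (n - k - l) ((w2 : ℂ) * y) *
        (w2 : ℂ) ^ k * (w1 : ℂ) ^ l * (w3 : ℂ) ^ (n - k - l) := by
  rw [sum_multinom_eq_coeff (fun k => E k (w1 * y)) (fun k => E k (w2 * y))
      (fun k => E k (w3 * y)),
    sum_multinom_eq_coeff (fun k => E k (w1 * y)) (fun k => E k (w3 * y))
      (fun k => E k (w2 * y))]
  congr 2
  refine mul_right_cancel₀ (mul_ne_zero (mul_ne_zero (expPS_add_one_ne_zero (w3 * d))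
    (expPS_add_one_ne_zero (w1 * d))) (expPS_add_one_ne_zero (w2 * d))) ?_
  have hexp : (w3 : ℂ) * (w1 * y) + w1 * (w2 * y) + w2 * (w3 * y) =
      w2 * (w1 * y) + w1 * (w3 * y) + w3 * (w2 * y) := by ring
  have hl := hE.rescale_mul_rescale_mul_rescale w3 w1 w2 (w1 * y) (w2 * y) (w3 * y)
  have hr := hE.rescale_mul_rescale_mul_rescale w2 w1 w3 (w1 * y) (w3 * y) (w2 * y)
  rw [hexp] at hl
  linear_combination hl - hr
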